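/- arXiv:2212.09029 — 6 statements merged into one kernel-verified Lean document; each statement's English description precedes it below -/
import Mathlib

section
/- Let v₁, v₂, v₃ ∈ ℝ² be affinely independent and let p, q ∈ ℝ² be any two points (possibly outside the triangle v₁v₂v₃). Then for every point x ∈ ℝ², L_p(x) − L_q(x) = T_q(x) − T_p(x), where L_p, L_q are the affine interpolants of the squared distances to p and q on the triple (v₁, v₂, v₃), and T_p, T_q are the tangent planes to the paraboloid at the lifted points of p and q. -/
/-- The tangent plane to the paraboloid `z = ‖x‖²` at the lifted point `(p, ‖p‖²)`:
`T p x = 2⟨p, x⟩ − ‖p‖²`. -/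
noncomputable def tangentPlane (p x : EuclideanSpace ℝ (Fin 2)) : ℝ :=
  2 * (inner ℝ p x : ℝ) - ‖p‖ ^ 2

/-- For an affinely independent triple `v₁, v₂, v₃ ∈ ℝ²` and any points
`p, q ∈ ℝ²`, if `Lp, Lq` are the affine interpolants of the squared distances to `p`
resp. `q` on `(v₁, v₂, v₃)`, then for every `x ∈ ℝ²`,
`Lp x − Lq x = T_q x − T_p x`. -/
theorem stmt0 (v₁ v₂ v₃ p q : EuclideanSpace ℝ (Fin 2))
    (hv : AffineIndependent ℝ ![v₁, v₂, v₃])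
    (Lp Lq : EuclideanSpace ℝ (Fin 2) →ᵃ[ℝ] ℝ)
    (hLp1 : Lp v₁ = ‖p - v₁‖ ^ 2) (hLp2 : Lp v₂ = ‖p - v₂‖ ^ 2)
    (hLp3 : Lp v₃ = ‖p - v₃‖ ^ 2)
    (hLq1 : Lq v₁ = ‖q - v₁‖ ^ 2) (hLq2 : Lq v₂ = ‖q - v₂‖ ^ 2)
    (hLq3 : Lq v₃ = ‖q - v₃‖ ^ 2)
    (x : EuclideanSpace ℝ (Fin 2)) :
    Lp x - Lq x = tangentPlane q x - tangentPlane p x := by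
  have htop : affineSpan ℝ (Set.range ![v₁, v₂, v₃]) = ⊤ := by
    apply hv.affineSpan_eq_top_iff_card_eq_finrank_add_one.mpr
    simp
  have hx : x ∈ affineSpan ℝ (Set.range ![v₁, v₂, v₃]) := by
    rw [htop]; exact AffineSubspace.mem_top ℝ _ x
  refine affineSpan_induction (p := fun x => Lp x - Lq x = tangentPlane q x - tangentPlane p x) hx ?_ ?_
  · intro y hy
    obtain ⟨i, rfl⟩ := hy
    unfold tangentPlane
    fin_cases i
    · simp [hLp1, hLq1, norm_sub_sq_real]; ring
    · simp [hLp2, hLq2, norm_sub_sq_real]; ring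
    · simp [hLp3, hLq3, norm_sub_sq_real]; ring
  · intro c u v w hu hv hw
    unfold tangentPlane at *
    rw [AffineMap.map_vadd, AffineMap.map_vadd, map_smul, map_smul, AffineMap.linearMap_vsub,
      AffineMap.linearMap_vsub]
    simp only [vsub_eq_sub, vadd_eq_add,
      inner_add_right, inner_smul_right, inner_sub_right, smul_eq_mul]
    linear_combination c * (hu - hv) + hw
end

section
/- Let v₁, v₂, v₃ ∈ ℝ² be affinely independent and let p₁, …, p_n ∈ ℝ² be a finite family of sites (possibly outside the triangle v₁v₂v₃). Then for every point x ∈ ℝ² and every index i, the following are equivalent: (1) ‖x − p_i‖ ≤ ‖x − p_j‖ for all j (i.e., x lies in the Voronoi cell of p_i); and (2) L_{p_i}(x) ≤ L_{p_j}(x) for all j (i.e., the lifted plane of p_i attains the lower envelope of the lifted planes at x). In particular, the lower envelope of the planes L_{p₁}, …, L_{p_n} defines the exact 2D Voronoi diagram of the sites p₁, …, p_n. -/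
/-- Let `v₁, v₂, v₃ ∈ ℝ²` be affinely independent and `p₁, …, pₙ ∈ ℝ²`
sites. For each `i`, let `L i` be the affine interpolant of the squared distances to
`p i` on `(v₁, v₂, v₃)`. Then for every `x ∈ ℝ²` and every `i`:
`x` lies in the Voronoi cell of `p i` (i.e. `‖x − p i‖ ≤ ‖x − p j‖` for all `j`)
iff the plane `L i` attains the lower envelope of the lifted planes at `x`
(i.e. `L i x ≤ L j x` for all `j`). -/
theorem stmt2 (v₁ v₂ v₃ : EuclideanSpace ℝ (Fin 2))
    (hv : AffineIndependent ℝ ![v₁, v₂, v₃])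
    (n : ℕ) (p : Fin n → EuclideanSpace ℝ (Fin 2))
    (L : Fin n → (EuclideanSpace ℝ (Fin 2) →ᵃ[ℝ] ℝ))
    (hL1 : ∀ i, L i v₁ = ‖p i - v₁‖ ^ 2)
    (hL2 : ∀ i, L i v₂ = ‖p i - v₂‖ ^ 2)
    (hL3 : ∀ i, L i v₃ = ‖p i - v₃‖ ^ 2)
    (x : EuclideanSpace ℝ (Fin 2)) (i : Fin n) :
    (∀ j, ‖x - p i‖ ≤ ‖x - p j‖) ↔ (∀ j, L i x ≤ L j x) := by
  have htop : affineSpan ℝ (Set.range ![v₁, v₂, v₃]) = ⊤ := by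
    apply hv.affineSpan_eq_top_iff_card_eq_finrank_add_one.mpr
    simp
  have hx : x ∈ affineSpan ℝ (Set.range ![v₁, v₂, v₃]) := by
    rw [htop]; trivial
  obtain ⟨w, hw, hxw⟩ := eq_affineCombination_of_mem_affineSpan_of_fintype hx
  have hLx : ∀ k, L k x = w 0 * ‖p k - v₁‖ ^ 2 + w 1 * ‖p k - v₂‖ ^ 2
      + w 2 * ‖p k - v₃‖ ^ 2 := by
    intro k
    rw [hxw, Finset.map_affineCombination _ _ _ hw,
      Finset.affineCombination_eq_linear_combination _ _ _ hw]
    simp [Fin.sum_univ_three, hL1, hL2, hL3]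
  rw [Finset.affineCombination_eq_linear_combination _ _ _ hw] at hxw
  simp only [Fin.sum_univ_three] at hxw hw
  have h0 : x 0 = w 0 * v₁ 0 + w 1 * v₂ 0 + w 2 * v₃ 0 := by
    rw [hxw]; simp
  have h1 : x 1 = w 0 * v₁ 1 + w 1 * v₂ 1 + w 2 * v₃ 1 := by
    rw [hxw]; simp
  refine forall_congr' fun j => ?_
  have key : L i x - L j x = ‖x - p i‖ ^ 2 - ‖x - p j‖ ^ 2 := by
    rw [hLx, hLx]
    simp only [EuclideanSpace.real_norm_sq_eq, Fin.sum_univ_two, PiLp.sub_apply]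
    rw [h0, h1]
    have hw2 : w 2 = 1 - w 0 - w 1 := by linarith
    rw [hw2]
    ring
  rw [← sq_le_sq₀ (norm_nonneg _) (norm_nonneg _)]
  constructor <;> intro h <;> linarith
end

section
/- Let v₁, v₂, v₃ ∈ ℝ² be affinely independent and let p, q ∈ ℝ² be any two distinct points (possibly outside the triangle v₁v₂v₃). Then L_p(p) − L_q(p) = L_q(q) − L_p(q) = −‖p − q‖². -/
/-- For an affinely independent triple `v₁, v₂, v₃ ∈ ℝ²` and any two
distinct points `p, q ∈ ℝ²`, with `Lp, Lq` the affine interpolants of the squared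
distances to `p` resp. `q` on `(v₁, v₂, v₃)`:
`Lp p − Lq p = Lq q − Lp q = −‖p − q‖²`. -/
theorem stmt4 (v₁ v₂ v₃ p q : EuclideanSpace ℝ (Fin 2))
    (hv : AffineIndependent ℝ ![v₁, v₂, v₃]) (hpq : p ≠ q)
    (Lp Lq : EuclideanSpace ℝ (Fin 2) →ᵃ[ℝ] ℝ)
    (hLp1 : Lp v₁ = ‖p - v₁‖ ^ 2) (hLp2 : Lp v₂ = ‖p - v₂‖ ^ 2)
    (hLp3 : Lp v₃ = ‖p - v₃‖ ^ 2)
    (hLq1 : Lq v₁ = ‖q - v₁‖ ^ 2) (hLq2 : Lq v₂ = ‖q - v₂‖ ^ 2)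
    (hLq3 : Lq v₃ = ‖q - v₃‖ ^ 2) :
    Lp p - Lq p = Lq q - Lp q ∧ Lq q - Lp q = -‖p - q‖ ^ 2 := by
  have htop : affineSpan ℝ (Set.range ![v₁, v₂, v₃]) = ⊤ := by
    rw [hv.affineSpan_eq_top_iff_card_eq_finrank_add_one]
    simp
  have key : ∀ x, Lp x - Lq x = ‖p‖ ^ 2 - ‖q‖ ^ 2 - 2 * inner ℝ (p - q) x := by
    intro x
    have hx : x ∈ affineSpan ℝ (Set.range ![v₁, v₂, v₃]) := by
      rw [htop]; trivial
    refine affineSpan_induction (p := fun x => Lp x - Lq x = ‖p‖ ^ 2 - ‖q‖ ^ 2 - 2 * inner ℝ (p - q) x) hx ?_ ?_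
    · intro y hy
      obtain ⟨i, rfl⟩ := hy
      fin_cases i
      · simp [hLp1, hLq1, norm_sub_sq_real, inner_sub_left]; ring
      · simp [hLp2, hLq2, norm_sub_sq_real, inner_sub_left]; ring
      · simp [hLp3, hLq3, norm_sub_sq_real, inner_sub_left]; ring
    · intro c u v w hu hv hw
      beta_reduce at hu hv hw ⊢
      rw [AffineMap.map_vadd, AffineMap.map_vadd, map_smul, map_smul,
        AffineMap.linearMap_vsub, AffineMap.linearMap_vsub]
      simp only [vsub_eq_sub, vadd_eq_add, smul_eq_mul, inner_add_right, inner_smul_right,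
        inner_sub_right (p - q) u v]
      linear_combination c * (hu - hv) + hw
  have h1 := key p
  have h2 := key q
  rw [inner_sub_left, real_inner_self_eq_norm_sq, real_inner_comm] at h1
  rw [inner_sub_left, real_inner_self_eq_norm_sq] at h2
  rw [norm_sub_sq_real]
  constructor <;> linarith [real_inner_comm p q]
end

section
/- Let v₁, v₂, v₃ ∈ ℝ² be affinely independent and let p, q ∈ ℝ² be any two distinct points (possibly outside the triangle v₁v₂v₃). Then the solution set of the equation L_p(x) = L_q(x) is exactly the perpendicular bisector of p and q, i.e., {x ∈ ℝ² : L_p(x) = L_q(x)} = {x ∈ ℝ² : ‖x − p‖ = ‖x − q‖}. -/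
/-- For an affinely independent triple `v₁, v₂, v₃ ∈ ℝ²` and any two
distinct points `p, q ∈ ℝ²`, with `Lp, Lq` the affine interpolants of the squared
distances to `p` resp. `q` on `(v₁, v₂, v₃)`, the solution set of `Lp x = Lq x` is
exactly the perpendicular bisector of `p` and `q`:
`{x | Lp x = Lq x} = {x | ‖x − p‖ = ‖x − q‖}`. -/
theorem stmt5 (v₁ v₂ v₃ p q : EuclideanSpace ℝ (Fin 2))
    (hv : AffineIndependent ℝ ![v₁, v₂, v₃]) (hpq : p ≠ q)
    (Lp Lq : EuclideanSpace ℝ (Fin 2) →ᵃ[ℝ] ℝ)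
    (hLp1 : Lp v₁ = ‖p - v₁‖ ^ 2) (hLp2 : Lp v₂ = ‖p - v₂‖ ^ 2)
    (hLp3 : Lp v₃ = ‖p - v₃‖ ^ 2)
    (hLq1 : Lq v₁ = ‖q - v₁‖ ^ 2) (hLq2 : Lq v₂ = ‖q - v₂‖ ^ 2)
    (hLq3 : Lq v₃ = ‖q - v₃‖ ^ 2) :
    {x : EuclideanSpace ℝ (Fin 2) | Lp x = Lq x} =
      {x : EuclideanSpace ℝ (Fin 2) | ‖x - p‖ = ‖x - q‖} := by
  have htop : affineSpan ℝ (Set.range ![v₁, v₂, v₃]) = ⊤ := by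
    rw [hv.affineSpan_eq_top_iff_card_eq_finrank_add_one]
    simp
  ext x
  have hx : x ∈ affineSpan ℝ (Set.range ![v₁, v₂, v₃]) := by
    rw [htop]; exact AffineSubspace.mem_top ℝ _ x
  obtain ⟨w, hw, hxw⟩ := eq_affineCombination_of_mem_affineSpan_of_fintype hx
  have hL : ∀ L : EuclideanSpace ℝ (Fin 2) →ᵃ[ℝ] ℝ,
      L x = w 0 * L v₁ + w 1 * L v₂ + w 2 * L v₃ := by
    intro L
    rw [hxw, Finset.map_affineCombination _ _ _ hw,
      Finset.affineCombination_eq_linear_combination _ _ _ hw]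
    simp [Fin.sum_univ_three]
  rw [Finset.affineCombination_eq_linear_combination _ _ _ hw] at hxw
  simp only [Fin.sum_univ_three] at hw hxw
  have h0 : x 0 = w 0 * v₁ 0 + w 1 * v₂ 0 + w 2 * v₃ 0 := by rw [hxw]; simp
  have h1 : x 1 = w 0 * v₁ 1 + w 1 * v₂ 1 + w 2 * v₃ 1 := by rw [hxw]; simp
  have key : Lp x - Lq x = ‖x - p‖ ^ 2 - ‖x - q‖ ^ 2 := by
    rw [hL Lp, hL Lq, hLp1, hLp2, hLp3, hLq1, hLq2, hLq3]
    simp only [EuclideanSpace.norm_sq_eq, Fin.sum_univ_two, PiLp.sub_apply, Real.norm_eq_abs,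
      sq_abs]
    have hw2 : w 2 = 1 - w 0 - w 1 := by linarith
    rw [h0, h1, hw2]
    ring
  simp only [Set.mem_setOf_eq]
  rw [← sq_eq_sq₀ (norm_nonneg (x - p)) (norm_nonneg (x - q))]
  constructor <;> intro h <;> linarith
end

section
/- Power-diagram extension of the lifting scheme: let v₁, v₂, v₃ ∈ ℝ² be affinely independent, let p₁, …, p_n ∈ ℝ² be sites with weights w₁, …, w_n ∈ ℝ, and for each i let L_{p_i}^{w_i} : ℝ² → ℝ be the unique affine map with L_{p_i}^{w_i}(v_k) = ‖p_i − v_k‖² − w_i for k = 1, 2, 3. Then for every x ∈ ℝ² and every index i, the following are equivalent: (1) ‖x − p_i‖² − w_i ≤ ‖x − p_j‖² − w_j for all j (i.e., x lies in the power cell of p_i); and (2) L_{p_i}^{w_i}(x) ≤ L_{p_j}^{w_j}(x) for all j. Hence the lower envelope of the weighted lifted planes defines the exact power diagram. -/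
/-- power-diagram extension of the lifting scheme: let
`v₁, v₂, v₃ ∈ ℝ²` be affinely independent, let `p₁, …, pₙ ∈ ℝ²` be sites with weights
`w₁, …, wₙ ∈ ℝ`, and for each `i` let `L i` be the unique affine map with
`L i vₖ = ‖p i − vₖ‖² − w i` for `k = 1, 2, 3`. Then for every `x ∈ ℝ²` and every `i`:
`x` lies in the power cell of `p i` (i.e. `‖x − p i‖² − w i ≤ ‖x − p j‖² − w j` for
all `j`) iff `L i x ≤ L j x` for all `j`. -/
theorem stmt10 (v₁ v₂ v₃ : EuclideanSpace ℝ (Fin 2))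
    (hv : AffineIndependent ℝ ![v₁, v₂, v₃])
    (n : ℕ) (p : Fin n → EuclideanSpace ℝ (Fin 2)) (w : Fin n → ℝ)
    (L : Fin n → (EuclideanSpace ℝ (Fin 2) →ᵃ[ℝ] ℝ))
    (hL1 : ∀ i, L i v₁ = ‖p i - v₁‖ ^ 2 - w i)
    (hL2 : ∀ i, L i v₂ = ‖p i - v₂‖ ^ 2 - w i)
    (hL3 : ∀ i, L i v₃ = ‖p i - v₃‖ ^ 2 - w i)
    (x : EuclideanSpace ℝ (Fin 2)) (i : Fin n) :
    (∀ j, ‖x - p i‖ ^ 2 - w i ≤ ‖x - p j‖ ^ 2 - w j) ↔ (∀ j, L i x ≤ L j x) := by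
  have htop : affineSpan ℝ (Set.range ![v₁, v₂, v₃]) = ⊤ := by
    rw [hv.affineSpan_eq_top_iff_card_eq_finrank_add_one]
    simp
  have key : ∀ j, L j x - L i x = (‖x - p j‖ ^ 2 - w j) - (‖x - p i‖ ^ 2 - w i) := by
    intro j
    have hx : x ∈ affineSpan ℝ (Set.range ![v₁, v₂, v₃]) := by rw [htop]; trivial
    refine affineSpan_induction (p := fun x => L j x - L i x =
      (‖x - p j‖ ^ 2 - w j) - (‖x - p i‖ ^ 2 - w i)) hx ?_ ?_
    · intro y hy
      obtain ⟨k, rfl⟩ := hy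
      fin_cases k
      · simp [hL1, norm_sub_rev]
      · simp [hL2, norm_sub_rev]
      · simp [hL3, norm_sub_rev]
    · intro c u v z hu hv' hz
      have e : ∀ k, L k (c • (u -ᵥ v) +ᵥ z) = c * (L k u - L k v) + L k z := by
        intro k
        rw [AffineMap.map_vadd, map_smul, AffineMap.linearMap_vsub]
        simp
      rw [e, e]
      simp only [EuclideanSpace.norm_sq_eq, Fin.sum_univ_two, Real.norm_eq_abs, sq_abs,
        vsub_eq_sub, vadd_eq_add, PiLp.sub_apply, PiLp.add_apply, PiLp.smul_apply,
        smul_eq_mul] at *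
      linear_combination c * (hu - hv') + hz
  constructor <;> intro h j <;> have h1 := h j <;> have h2 := key j <;> linarith
end

section
/- Compatibility with the Euclidean Voronoi diagram on a planar triangle in 3D: let v₁, v₂, v₃ ∈ ℝ³ be affinely independent and let p₁, …, p_n ∈ ℝ³ be sites; for each i let L_{p_i} be the unique affine map on the affine span of {v₁, v₂, v₃} with L_{p_i}(v_k) = ‖p_i − v_k‖² for k = 1, 2, 3. Then for every point x in the affine span and every index i, ‖x − p_i‖ ≤ ‖x − p_j‖ for all j if and only if L_{p_i}(x) ≤ L_{p_j}(x) for all j; i.e., within the triangle's plane, the lower envelope of the lifted planes reports the exact Euclidean Voronoi diagram of the sites restricted to that plane. -/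
/-- compatibility with the Euclidean Voronoi diagram on a planar
triangle in ℝ³: let `v₁, v₂, v₃ ∈ ℝ³` be affinely independent, `p₁, …, pₙ ∈ ℝ³`
sites, and for each `i` let `L i` be the affine map on the affine span of
`{v₁, v₂, v₃}` with `L i vₖ = ‖p i − vₖ‖²` for `k = 1, 2, 3`. Then for every point
`x` in the affine span and every `i`: `‖x − p i‖ ≤ ‖x − p j‖` for all `j` iff
`L i x ≤ L j x` for all `j`; i.e. within the triangle's plane the lower envelope of
the lifted planes reports the exact Euclidean Voronoi diagram restricted to
that plane. -/
theorem stmt12 (v₁ v₂ v₃ : EuclideanSpace ℝ (Fin 3))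
    (hv : AffineIndependent ℝ ![v₁, v₂, v₃])
    (n : ℕ) (p : Fin n → EuclideanSpace ℝ (Fin 3))
    (L : Fin n →
      ((affineSpan ℝ {v₁, v₂, v₃} : AffineSubspace ℝ (EuclideanSpace ℝ (Fin 3)))
        →ᵃ[ℝ] ℝ))
    (hL1 : ∀ i, L i ⟨v₁, mem_affineSpan ℝ (by simp)⟩ = ‖p i - v₁‖ ^ 2)
    (hL2 : ∀ i, L i ⟨v₂, mem_affineSpan ℝ (by simp)⟩ = ‖p i - v₂‖ ^ 2)
    (hL3 : ∀ i, L i ⟨v₃, mem_affineSpan ℝ (by simp)⟩ = ‖p i - v₃‖ ^ 2)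
    (x : affineSpan ℝ {v₁, v₂, v₃}) (i : Fin n) :
    (∀ j, ‖(x : EuclideanSpace ℝ (Fin 3)) - p i‖
        ≤ ‖(x : EuclideanSpace ℝ (Fin 3)) - p j‖) ↔
      (∀ j, L i x ≤ L j x) := by
  have key : ∀ (j : Fin n) (y : EuclideanSpace ℝ (Fin 3))
      (hy : y ∈ affineSpan ℝ {v₁, v₂, v₃}),
      L i ⟨y, hy⟩ - L j ⟨y, hy⟩ = ‖y - p i‖ ^ 2 - ‖y - p j‖ ^ 2 := by
    intro j y hy
    induction hy using affineSpan_induction' with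
    | mem y hy =>
      simp only [Set.mem_insert_iff, Set.mem_singleton_iff] at hy
      rcases hy with rfl | rfl | rfl
      · rw [hL1, hL1, norm_sub_rev, norm_sub_rev (p j)]
      · rw [hL2, hL2, norm_sub_rev, norm_sub_rev (p j)]
      · rw [hL3, hL3, norm_sub_rev, norm_sub_rev (p j)]
    | smul_vsub_vadd c u hu v hv w hw h1 h2 h3 =>
      have e : ∀ k, ∀ h, L k ⟨c • (u -ᵥ v) +ᵥ w, h⟩
          = c * (L k ⟨u, hu⟩ - L k ⟨v, hv⟩) + L k ⟨w, hw⟩ := by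
        intro k h
        have h0 := (L k).map_vadd ⟨w, hw⟩
          (c • ((⟨u, hu⟩ : affineSpan ℝ {v₁, v₂, v₃}) -ᵥ ⟨v, hv⟩))
        rw [map_smul, AffineMap.linearMap_vsub] at h0
        exact h0
      rw [e, e]
      simp only [vsub_eq_sub, vadd_eq_add, norm_sub_sq_real, inner_add_left, inner_smul_left,
        inner_sub_left, conj_trivial] at h1 h2 h3 ⊢
      linear_combination c * h1 - c * h2 + h3
  refine forall_congr' fun j => ?_
  have h := key j x x.2
  rw [← sq_le_sq₀ (norm_nonneg _) (norm_nonneg _)]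
  constructor <;> intro h' <;> simp only [Subtype.coe_eta] at h <;> linarith
end
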